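/- (Variant of Chang's covering lemma) Let G be an Abelian group, A, S finite nonempty subsets with 0 ∈ A and |kA + S| < 2^k |S| for some natural number k ≥ 1. Then there is a subset T ⊆ A with |T| < k such that A ⊆ Span(T) + S − S, where Span(T) = { Σ_{t∈T} σ_t t : σ_t ∈ {−1,0,1} }. -/

import Mathlib

open Pointwise

theorem chang_aux_span {G : Type*} [AddCommGroup G] [DecidableEq G]
    (S T X Y : Finset G) (hX : X ⊆ T) (hY : Y ⊆ T) (a s s' : G) (hs : s ∈ S) (hs' : s' ∈ S)
    (e : a + ∑ x ∈ X, x + s = ∑ x ∈ Y, x + s') :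
    ∃ σ : G → ℤ, (∀ t ∈ T, σ t = -1 ∨ σ t = 0 ∨ σ t = 1) ∧
      a - ∑ t ∈ T, σ t • t ∈ S - S := by
  refine ⟨fun t => (if t ∈ Y then 1 else 0) - (if t ∈ X then 1 else 0), ?_, ?_⟩
  · intro t _
    by_cases h1 : t ∈ Y <;> by_cases h2 : t ∈ X <;> simp [h1, h2]
  · have : ∑ t ∈ T, (((if t ∈ Y then 1 else 0) - (if t ∈ X then 1 else 0) : ℤ)) • t
        = ∑ x ∈ Y, x - ∑ x ∈ X, x := by
      simp only [sub_smul, ite_smul, one_smul, zero_smul, Finset.sum_sub_distrib,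
        Finset.sum_ite_mem, Finset.inter_eq_right.2 hX, Finset.inter_eq_right.2 hY]
    simp only [this]
    refine Finset.mem_sub.2 ⟨s', hs', s, hs, ?_⟩
    have e2 : a = ∑ x ∈ Y, x + s' - s - ∑ x ∈ X, x := by rw [← e]; abel
    rw [e2]; abel

theorem chang_aux_sum {G : Type*} [AddCommGroup G] [DecidableEq G]
    (A X : Finset G) (hX : X ⊆ A) : ∑ x ∈ X, x ∈ X.card • A := by
  induction X using Finset.induction_on with
  | empty => simp
  | insert a X ha ih =>
    rw [Finset.sum_insert ha, Finset.card_insert_of_notMem ha, succ_nsmul']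
    exact Finset.add_mem_add (hX (Finset.mem_insert_self _ _))
      (ih ((Finset.subset_insert _ _).trans hX))

theorem chang_covering_lemma_variant {G : Type*} [AddCommGroup G] [DecidableEq G]
    (A S : Finset G) (hA : A.Nonempty) (hS : S.Nonempty) (h0 : (0 : G) ∈ A)
    (k : ℕ) (hk : 1 ≤ k) (h : (k • A + S).card < 2 ^ k * S.card) :
    ∃ T ⊆ A, T.card < k ∧ ∀ a ∈ A, ∃ σ : G → ℤ,
      (∀ t ∈ T, σ t = -1 ∨ σ t = 0 ∨ σ t = 1) ∧
      a - ∑ t ∈ T, σ t • t ∈ S - S := by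
  classical
  let P : Finset G → Prop := fun T => ∀ X ⊆ T, ∀ Y ⊆ T, ∀ s ∈ S, ∀ s' ∈ S,
    ∑ x ∈ X, x + s = ∑ x ∈ Y, x + s' → X = Y
  have hne : (A.powerset.filter P).Nonempty := by
    refine ⟨∅, Finset.mem_filter.2 ⟨Finset.empty_mem_powerset _, ?_⟩⟩
    intro X hX Y hY _ _ _ _ _
    rw [Finset.subset_empty.1 hX, Finset.subset_empty.1 hY]
  obtain ⟨T, hT, hmax⟩ := Finset.exists_max_image _ Finset.card hne
  obtain ⟨hTA, hPT⟩ := Finset.mem_filter.1 hT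
  rw [Finset.mem_powerset] at hTA
  refine ⟨T, hTA, ?_, ?_⟩
  · by_contra! hc
    obtain ⟨U, hUT, hU⟩ := Finset.exists_subset_card_eq hc
    have : (U.powerset ×ˢ S).card ≤ (k • A + S).card := by
      refine Finset.card_le_card_of_injOn (fun p => ∑ x ∈ p.1, x + p.2) ?_ ?_
      · rintro ⟨X, s⟩ hp
        simp only [Finset.coe_product, Set.mem_prod, Finset.mem_coe, Finset.mem_powerset] at hp
        refine Finset.add_mem_add ?_ hp.2
        exact Finset.nsmul_subset_nsmul_right h0 (hU ▸ Finset.card_le_card hp.1)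
          (chang_aux_sum A X (hp.1.trans (hUT.trans hTA)))
      · rintro ⟨X, s⟩ hp ⟨Y, s'⟩ hq e
        simp only [Finset.coe_product, Set.mem_prod, Finset.mem_coe, Finset.mem_powerset] at hp hq
        have e' : ∑ x ∈ X, x + s = ∑ x ∈ Y, x + s' := e
        obtain rfl := hPT X (hp.1.trans hUT) Y (hq.1.trans hUT) s hp.2 s' hq.2 e'
        rw [add_left_cancel e']
    rw [Finset.card_product, Finset.card_powerset, hU] at this
    omega
  · intro a ha
    by_cases haT : a ∈ T
    · obtain ⟨s, hs⟩ := hS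
      exact chang_aux_span S T ∅ {a} (by simp) (by simpa using haT) a s s hs hs (by simp)
    have hnP : ¬ P (insert a T) := by
      intro hP
      have := hmax (insert a T) (Finset.mem_filter.2
        ⟨Finset.mem_powerset.2 (Finset.insert_subset ha hTA), hP⟩)
      rw [Finset.card_insert_of_notMem haT] at this
      omega
    simp only [P] at hnP
    push Not at hnP
    obtain ⟨X, hX, Y, hY, s, hs, s', hs', e, hXY⟩ := hnP
    have hX' := Finset.subset_insert_iff.1 hX
    have hY' := Finset.subset_insert_iff.1 hY
    by_cases h1 : a ∈ X <;> by_cases h2 : a ∈ Y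
    · exfalso
      rw [← Finset.add_sum_erase X _ h1, ← Finset.add_sum_erase Y _ h2, add_assoc, add_assoc] at e
      have := hPT _ hX' _ hY' s hs s' hs' (add_left_cancel e)
      rw [← Finset.insert_erase h1, ← Finset.insert_erase h2, this] at hXY
      exact hXY rfl
    · rw [Finset.erase_eq_of_notMem h2] at hY'
      rw [← Finset.add_sum_erase X _ h1] at e
      exact chang_aux_span S T _ Y hX' hY' a s s' hs hs' e
    · rw [Finset.erase_eq_of_notMem h1] at hX'
      rw [← Finset.add_sum_erase Y _ h2] at e
      exact chang_aux_span S T _ X hY' hX' a s' s hs' hs e.symm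
    · rw [Finset.erase_eq_of_notMem h1] at hX'
      rw [Finset.erase_eq_of_notMem h2] at hY'
      exact absurd (hPT X hX' Y hY' s hs s' hs' e) hXY
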